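/- There exist constants ρ>0 and α>0 such that for every n∈ℕ there exist k ≥ ρ·n, a randomized encoding function E : {0,1}^k → {0,1}^n, and a deterministic decoding function D : {0,1}^n → {0,1}^k, such that D(E(x)) = x with probability 1 for every message x, and for every affine tampering function f : F₂^n → F₂^n there exists a probability distribution G over NM_k such that for every x ∈ {0,1}^k, Δ(D(f(E(x))), G(x)) ≤ 2^{−αk}, where G(x) denotes the distribution obtained by sampling g from G and outputting g(x). (Efficiency of E and D is omitted; only existence is asserted.) -/

import Mathlib

/-- `{0,1}^n` identified with the vector space `F₂ⁿ`. -/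
abbrev BV (n : ℕ) : Type := Fin n → ZMod 2

/-- `Bits n` is the set of `n`-bit strings `{0,1}^n` (used for messages). -/
abbrev Bits (n : ℕ) : Type := Fin n → Bool

/-- Statistical distance `Δ(p,q) = max_{T ⊆ S} |p(T) - q(T)|`. -/
noncomputable def sd {α : Type*} [Fintype α] (p q : PMF α) : ℝ :=
  ⨆ T : Finset α, |∑ x ∈ T, (p x).toReal - ∑ x ∈ T, (q x).toReal|

/-!
The set `NM_k` of trivial manipulation functions on `k`-bit strings (the identity and
all constant functions) is modeled by `Option (Bits k)`: `none` is the identity and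
`some c` is the constant function with value `c`.  Applying `g : Option (Bits k)` to a
message `x` is `g.getD x`.  A distribution `G` over `NM_k` is a `PMF (Option (Bits k))`,
and `G(x)` is `G.map (fun g => g.getD x)`.
-/

section

open Finset

/-- Moment generating function bound for a centred indicator of a uniform variable. -/
lemma sum_exp_centred_indicator_le {β : Type*} [Fintype β] [DecidableEq β] (x : β) {u : ℝ}
    (hu : |u| ≤ 1) :
    ∑ z : β, Real.exp (u * ((if z = x then 1 else 0) - 1 / (Fintype.card β : ℝ))) ≤
      Fintype.card β * Real.exp (u ^ 2) := by
  have hK : (1 : ℝ) ≤ Fintype.card β := by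
    exact_mod_cast Fintype.card_pos_iff.mpr ⟨x⟩
  have hp : 0 ≤ 1 / (Fintype.card β : ℝ) := by positivity
  have hp1 : 1 / (Fintype.card β : ℝ) ≤ 1 := by
    rw [div_le_one (by linarith)]; exact hK
  set p := 1 / (Fintype.card β : ℝ) with hpdef
  have hterm : ∀ z : β, Real.exp (u * ((if z = x then 1 else 0) - p)) ≤
      1 + u * ((if z = x then 1 else 0) - p) + u ^ 2 := by
    intro z
    have hd : |(if z = x then (1 : ℝ) else 0) - p| ≤ 1 := by
      split_ifs <;> rw [abs_le] <;> constructor <;> linarith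
    have h1 : |u * ((if z = x then 1 else 0) - p)| ≤ |u| := by
      rw [abs_mul]; exact mul_le_of_le_one_right (abs_nonneg _) hd
    have h2 := (abs_le.mp (Real.abs_exp_sub_one_sub_id_le (h1.trans hu))).2
    have h3 := sq_le_sq.mpr h1
    linarith
  calc _ ≤ ∑ z : β, (1 + u * ((if z = x then 1 else 0) - p) + u ^ 2) :=
        sum_le_sum fun z _ => hterm z
    _ = Fintype.card β * (u ^ 2 + 1) := by
        rw [sum_add_distrib, sum_add_distrib, ← mul_sum, sum_sub_distrib]
        simp [hpdef]
        field_simp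
        ring
    _ ≤ _ := by gcongr; exact Real.add_one_le_exp _

/-- Resampling one coordinate does not change the sum over all functions. -/
lemma sum_sum_update {α β : Type*} [Fintype α] [DecidableEq α] [Fintype β]
    (h : (α → β) → ℝ) (c : α) :
    ∑ d : α → β, ∑ z : β, h (Function.update d c z) =
      Fintype.card β * ∑ d : α → β, h d := by
  classical
  have hinv : Function.Involutive
      (fun q : (α → β) × β => (Function.update q.1 c q.2, q.1 c)) := by
    rintro ⟨d, z⟩
    simp
  rw [← Fintype.sum_prod_type' (fun d z => h (Function.update d c z)),
    Fintype.sum_equiv hinv.toPerm (fun q => h (Function.update q.1 c q.2)) (fun q => h q.1)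
      (fun q => rfl), Fintype.sum_prod_type]
  simp [mul_sum]

lemma sum_exp_weighted_le {α β : Type*} [Fintype α] [DecidableEq α] [Fintype β] [DecidableEq β]
    (x : β) (w : α → (α → β) → ℝ) (hw : ∀ c d, |w c d| ≤ 1) {l : ℝ} (hl : |l| ≤ 1)
    (S : Finset α)
    (hS : ∀ c ∈ S, ∀ c' ∈ S, ∀ d z, w c (Function.update d c' z) = w c d) :
    ∑ d : α → β, Real.exp (l * ∑ c ∈ S,
        ((if d c = x then 1 else 0) - 1 / (Fintype.card β : ℝ)) * w c d) ≤
      Fintype.card (α → β) * Real.exp (l ^ 2 * #S) := by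
  induction S using Finset.induction_on with
  | empty => simp
  | insert c S hc ih =>
    have hK : (0 : ℝ) < Fintype.card β := by
      exact_mod_cast Fintype.card_pos_iff.mpr ⟨x⟩
    have ih' := ih fun a ha b hb =>
      hS a (mem_insert_of_mem ha) b (mem_insert_of_mem hb)
    have hstep : ∀ d : α → β, ∑ z : β, Real.exp (l * ∑ a ∈ insert c S,
        ((if Function.update d c z a = x then 1 else 0) - 1 / (Fintype.card β : ℝ)) *
          w a (Function.update d c z)) ≤
        Fintype.card β * Real.exp (l ^ 2) * Real.exp (l * ∑ a ∈ S,
          ((if d a = x then 1 else 0) - 1 / (Fintype.card β : ℝ)) * w a d) := by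
      intro d
      have hsum : ∀ z : β, Real.exp (l * ∑ a ∈ insert c S,
          ((if Function.update d c z a = x then 1 else 0) - 1 / (Fintype.card β : ℝ)) *
            w a (Function.update d c z)) =
          Real.exp (l * w c d * ((if z = x then 1 else 0) - 1 / (Fintype.card β : ℝ))) *
          Real.exp (l * ∑ a ∈ S,
            ((if d a = x then 1 else 0) - 1 / (Fintype.card β : ℝ)) * w a d) := by
        intro z
        rw [← Real.exp_add, sum_insert hc, hS c (mem_insert_self _ _) c (mem_insert_self _ _),
          Function.update_self]
        have : ∀ a ∈ S, ((if Function.update d c z a = x then 1 else 0) -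
            1 / (Fintype.card β : ℝ)) * w a (Function.update d c z) =
            ((if d a = x then 1 else 0) - 1 / (Fintype.card β : ℝ)) * w a d := by
          intro a ha
          rw [hS a (mem_insert_of_mem ha) c (mem_insert_self _ _),
            Function.update_of_ne (ne_of_mem_of_not_mem ha hc)]
        rw [sum_congr rfl this]
        ring_nf
      simp_rw [hsum, ← sum_mul]
      gcongr
      have h1 : |l * w c d| ≤ |l| := by
        rw [abs_mul]; exact mul_le_of_le_one_right (abs_nonneg _) (hw c d)
      refine (sum_exp_centred_indicator_le x (h1.trans hl)).trans ?_
      have h2 := sq_le_sq.mpr h1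
      gcongr
    have hmain := (sum_sum_update (fun d : α → β => Real.exp (l * ∑ a ∈ insert c S,
      ((if d a = x then 1 else 0) - 1 / (Fintype.card β : ℝ)) * w a d)) c).symm.trans_le
        (sum_le_sum fun d _ => hstep d)
    rw [← mul_sum, mul_assoc] at hmain
    have hmain' := le_of_mul_le_mul_left hmain hK
    refine hmain'.trans ?_
    calc _ ≤ Real.exp (l ^ 2) * (Fintype.card (α → β) * Real.exp (l ^ 2 * #S)) := by gcongr
      _ = _ := by
        rw [card_insert_of_notMem hc, mul_left_comm, ← Real.exp_add]
        push_cast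
        ring_nf

/-- A union bound: some function `d` is simultaneously well distributed for a finite family of
weighted counting tests. -/
lemma exists_forall_abs_weighted_le {α β ι : Type*} [Fintype α] [DecidableEq α] [Fintype β]
    [DecidableEq β] [Nonempty β] [Fintype ι]
    (S : ι → Finset α) (x : ι → β) (w : ι → α → (α → β) → ℝ) (hw : ∀ i c d, |w i c d| ≤ 1)
    (hS : ∀ i, ∀ c ∈ S i, ∀ c' ∈ S i, ∀ d z, w i c (Function.update d c' z) = w i c d)
    {l : ℝ} (hl : 0 < l) (hl1 : l ≤ 1) :
    ∃ d : α → β, ∀ i, |∑ c ∈ S i,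
        ((if d c = x i then 1 else 0) - 1 / (Fintype.card β : ℝ)) * w i c d| ≤
      Real.log (2 * Fintype.card ι) / l + l * Fintype.card α := by
  set Z : ι → (α → β) → ℝ := fun i d => ∑ c ∈ S i,
        ((if d c = x i then 1 else 0) - 1 / (Fintype.card β : ℝ)) * w i c d with hZ
  have hcard : ∀ i, (#(S i) : ℝ) ≤ Fintype.card α := fun i => by
    exact_mod_cast card_le_univ _
  have hbound : ∀ m : ℝ, m ^ 2 = l ^ 2 → ∀ i, ∑ d, Real.exp (m * Z i d) ≤
      Fintype.card (α → β) * Real.exp (l ^ 2 * Fintype.card α) := by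
    intro m hm i
    have hm1 : |m| ≤ 1 := by
      rw [(sq_eq_sq_iff_abs_eq_abs _ _).mp hm, abs_of_pos hl]; exact hl1
    refine (sum_exp_weighted_le (x i) (w i) (hw i) hm1 (S i) (hS i)).trans ?_
    rw [hm]
    have := hcard i
    gcongr
  have htot : ∑ d : α → β, ∑ i, (Real.exp (l * Z i d) + Real.exp (-l * Z i d)) ≤
      ∑ _d : α → β, 2 * Fintype.card ι * Real.exp (l ^ 2 * Fintype.card α) := by
    rw [sum_comm]
    simp_rw [sum_add_distrib]
    refine (add_le_add (sum_le_sum fun i _ => hbound l rfl i)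
      (sum_le_sum fun i _ => hbound (-l) (by ring) i)).trans ?_
    simp only [sum_const, card_univ, nsmul_eq_mul]
    apply le_of_eq
    ring
  obtain ⟨d, -, hd⟩ := exists_le_of_sum_le univ_nonempty htot
  refine ⟨d, fun i => ?_⟩
  have hi : Real.exp (l * Z i d) + Real.exp (-l * Z i d) ≤
      2 * Fintype.card ι * Real.exp (l ^ 2 * Fintype.card α) :=
    (single_le_sum (f := fun i => Real.exp (l * Z i d) + Real.exp (-l * Z i d))
      (fun j _ => by positivity) (mem_univ i)).trans hd
  have hι : (0 : ℝ) < 2 * Fintype.card ι := by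
    have : 0 < Fintype.card ι := Fintype.card_pos_iff.mpr ⟨i⟩
    positivity
  have hlog : ∀ y : ℝ, Real.exp y ≤ 2 * Fintype.card ι * Real.exp (l ^ 2 * Fintype.card α) →
      y ≤ Real.log (2 * Fintype.card ι) + l ^ 2 * Fintype.card α := by
    intro y hy
    rw [← Real.exp_log hι, ← Real.exp_add, Real.exp_le_exp] at hy
    simpa using hy
  have h1 := hlog _ ((le_add_of_nonneg_right (Real.exp_pos _).le).trans hi)
  have h2 := hlog _ ((le_add_of_nonneg_left (Real.exp_pos _).le).trans hi)
  have h3 : l * |Z i d| ≤ Real.log (2 * Fintype.card ι) + l ^ 2 * Fintype.card α := by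
    rcases abs_cases (Z i d) with ⟨h, _⟩ | ⟨h, _⟩ <;> rw [h] <;> linarith
  have h4 : Real.log (2 * Fintype.card ι) / l + l * Fintype.card α =
      (Real.log (2 * Fintype.card ι) + l ^ 2 * Fintype.card α) / l := by
    field_simp
  rw [h4, le_div_iff₀ hl]
  linarith

/-- A colouring of `𝔽₂ⁿ` for which no point has the colour of its image under `f`, except for
the fixed points of `f`. -/
noncomputable def differenceColour {n : ℕ} (f : BV n → BV n) (c : BV n) :
    Option (Fin n × ZMod 2) :=
  open Classical in
  if h : ∃ i, f c i ≠ c i then some (h.choose, c h.choose) else none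

lemma differenceColour_ne {n : ℕ} (f : BV n → BV n) {c d : BV n} (hc : f c ≠ c)
    (hcd : differenceColour f d = differenceColour f c) : f c ≠ d := by
  classical
  have hc' : ∃ i, f c i ≠ c i := Function.ne_iff.mp hc
  rintro rfl
  rw [differenceColour, differenceColour, dif_pos hc'] at hcd
  split_ifs at hcd with h
  simp only [Option.some.injEq, Prod.mk.injEq] at hcd
  have := hc'.choose_spec
  rw [hcd.1] at hcd
  exact this hcd.2

/-- Whether tampering the codeword `c` of `x` by `f` leads to a decoded message in `T`. -/
def TamperedMem {α β : Type*} (f : α → α) (d : α → β) (x : β) (T : Finset β) (c : α) : Prop :=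
  (f c = c ∧ x ∈ T) ∨ (f c ≠ c ∧ d (f c) ∈ T)

/-- A decoder that is well distributed against all affine maps. -/
lemma exists_decoder (n k : ℕ) {l : ℝ} (hl : 0 < l) (hl1 : l ≤ 1) :
    ∃ D : BV n → Bits k, ∀ (M : BV n →ₗ[ZMod 2] BV n) (v : BV n) (x : Bits k)
      (T : Finset (Bits k)),
      open Classical in
      |(#{c | D c = x ∧ TamperedMem (fun c => M c + v) D x T c} : ℝ) -
        (#{c | TamperedMem (fun c => M c + v) D x T c} : ℝ) / 2 ^ k| ≤
      (2 * n + 1) * ((n ^ 2 + 3 * n + k + 2 ^ k + 2) / l + l * 2 ^ n) := by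
  classical
  let g : Matrix (Fin n) (Fin n) (ZMod 2) × BV n → BV n → BV n :=
    fun p c => Matrix.toLin' p.1 c + p.2
  obtain ⟨D, hD⟩ := exists_forall_abs_weighted_le
    (α := BV n) (β := Bits k)
    (ι := (Matrix (Fin n) (Fin n) (ZMod 2) × BV n) × Bits k × Finset (Bits k) ×
      Option (Fin n × ZMod 2))
    (fun i => univ.filter fun c => differenceColour (g i.1) c = i.2.2.2)
    (fun i => i.2.1)
    (fun i c d => if TamperedMem (g i.1) d i.2.1 i.2.2.1 c then 1 else 0)
    (fun i c d => by split_ifs <;> simp)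
    (by
      rintro ⟨p, x, T, q⟩ c hc c' hc' d z
      simp only [mem_filter, mem_univ, true_and] at hc hc'
      simp only
      congr 1
      simp only [TamperedMem]
      by_cases h : g p c = c
      · simp [h]
      · rw [Function.update_of_ne (differenceColour_ne (g p) h (hc'.trans hc.symm))])
    hl hl1
  refine ⟨D, fun M v x T => ?_⟩
  have hg : (fun c => M c + v) = g (LinearMap.toMatrix' M, v) := by
    funext c; simp [g]
  rw [hg]
  set p : Matrix (Fin n) (Fin n) (ZMod 2) × BV n := (LinearMap.toMatrix' M, v)
  have hcardβ : (Fintype.card (Bits k) : ℝ) = 2 ^ k := by simp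
  have hcardα : (Fintype.card (BV n) : ℝ) = 2 ^ n := by simp [ZMod.card]
  have hL : Real.log (2 * (Fintype.card ((Matrix (Fin n) (Fin n) (ZMod 2) × BV n) × Bits k ×
      Finset (Bits k) × Option (Fin n × ZMod 2)) : ℝ)) ≤ n ^ 2 + 3 * n + k + 2 ^ k + 2 := by
    have hc : 2 * (Fintype.card ((Matrix (Fin n) (Fin n) (ZMod 2) × BV n) × Bits k ×
        Finset (Bits k) × Option (Fin n × ZMod 2)) : ℝ) =
        2 ^ (n ^ 2 + n + k + 2 ^ k + 1) * (2 * n + 1) := by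
      have : Fintype.card (Matrix (Fin n) (Fin n) (ZMod 2)) = 2 ^ (n ^ 2) := by
        rw [Fintype.card_congr (Matrix.of (m := Fin n) (n := Fin n) (α := ZMod 2)).symm,
          Fintype.card_fun, Fintype.card_fun, ZMod.card, Fintype.card_fin, ← pow_mul, sq]
      simp only [Fintype.card_prod, this, Fintype.card_option, Fintype.card_finset,
        Fintype.card_fun, ZMod.card, Fintype.card_fin, Fintype.card_bool]
      push_cast
      ring
    rw [hc, Real.log_mul (by positivity) (by positivity), Real.log_pow]
    have h2 : Real.log 2 ≤ 1 := by linarith [Real.log_two_lt_d9]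
    have h3 : Real.log (2 * n + 1) ≤ 2 * n := by
      have := Real.log_le_sub_one_of_pos (show (0 : ℝ) < 2 * n + 1 by positivity)
      linarith
    have h4 : ((n ^ 2 + n + k + 2 ^ k + 1 : ℕ) : ℝ) * Real.log 2 ≤
        ((n ^ 2 + n + k + 2 ^ k + 1 : ℕ) : ℝ) := mul_le_of_le_one_right (by positivity) h2
    push_cast at h4 ⊢
    linarith
  have hsum : (#{c | D c = x ∧ TamperedMem (g p) D x T c} : ℝ) -
        (#{c | TamperedMem (g p) D x T c} : ℝ) / 2 ^ k =
      ∑ q : Option (Fin n × ZMod 2), ∑ c with differenceColour (g p) c = q,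
        ((if D c = x then 1 else 0) - 1 / (Fintype.card (Bits k) : ℝ)) *
          (if TamperedMem (g p) D x T c then 1 else 0) := by
    rw [sum_fiberwise, hcardβ]
    simp_rw [sub_mul]
    rw [sum_sub_distrib, ← mul_sum]
    simp_rw [ite_zero_mul_ite_zero, mul_one]
    simp only [card_filter, Nat.cast_sum, Nat.cast_ite, Nat.cast_one, Nat.cast_zero]
    ring
  rw [hsum]
  refine (abs_sum_le_sum_abs _ _).trans ?_
  refine (sum_le_sum fun q _ => (hD (p, x, T, q)).trans
    (add_le_add_left (div_le_div_of_nonneg_right hL hl.le) _)).trans ?_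
  rw [sum_const, hcardα, nsmul_eq_mul]
  have hcolour : (#(univ : Finset (Option (Fin n × ZMod 2))) : ℝ) = 2 * n + 1 := by
    simp [ZMod.card, mul_comm]
  rw [hcolour]

lemma sum_map_toReal {α β : Type*} [Fintype α] [DecidableEq β] (p : PMF α) (g : α → β)
    (T : Finset β) :
    ∑ y ∈ T, ((p.map g) y).toReal = ∑ c with g c ∈ T, (p c).toReal := by
  classical
  have h : ∀ y, ((p.map g) y).toReal = ∑ c, if g c = y then (p c).toReal else 0 := by
    intro y
    rw [PMF.map_apply, tsum_fintype, ENNReal.toReal_sum]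
    · refine sum_congr rfl fun c _ => ?_
      by_cases hc : g c = y
      · simp [hc]
      · simp [hc, Ne.symm hc]
    · intro c _
      split_ifs
      · exact PMF.apply_ne_top p c
      · simp
  simp_rw [h]
  rw [sum_comm, sum_filter]
  simp

lemma sum_map_uniformOfFinset_toReal {α β : Type*} [Fintype α] [DecidableEq α] [DecidableEq β]
    (S : Finset α) (hS : S.Nonempty) (g : α → β) (T : Finset β) :
    ∑ y ∈ T, (((PMF.uniformOfFinset S hS).map g) y).toReal =
      (#(S.filter fun c => g c ∈ T) : ℝ) / #S := by
  rw [sum_map_toReal]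
  have h : ∀ c, (PMF.uniformOfFinset S hS c).toReal = if c ∈ S then (#S : ℝ)⁻¹ else 0 := by
    intro c
    rw [PMF.uniformOfFinset_apply]
    split_ifs <;> simp
  simp_rw [h]
  rw [← sum_filter, filter_filter, sum_const, nsmul_eq_mul, div_eq_mul_inv]
  congr 3
  ext c
  simp [and_comm]

lemma sum_toReal_eq_one {α : Type*} [Fintype α] (p : PMF α) : ∑ y, (p y).toReal = 1 := by
  have h := p.tsum_coe
  rw [tsum_fintype] at h
  rw [← ENNReal.toReal_sum fun c _ => PMF.apply_ne_top p c, h, ENNReal.toReal_one]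

lemma sum_toReal_le_one {α : Type*} [Fintype α] (p : PMF α) (T : Finset α) :
    ∑ y ∈ T, (p y).toReal ≤ 1 := by
  rw [← sum_toReal_eq_one p]
  exact sum_le_univ_sum_of_nonneg fun _ => ENNReal.toReal_nonneg

lemma sd_le_one {α : Type*} [Fintype α] (p q : PMF α) : sd p q ≤ 1 := by
  refine ciSup_le fun T => ?_
  have hp : 0 ≤ ∑ y ∈ T, (p y).toReal := sum_nonneg fun _ _ => ENNReal.toReal_nonneg
  have hq : 0 ≤ ∑ y ∈ T, (q y).toReal := sum_nonneg fun _ _ => ENNReal.toReal_nonneg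
  have := sum_toReal_le_one p T
  have := sum_toReal_le_one q T
  rw [abs_le]
  constructor <;> linarith

/-- Any distribution on a two-point space is at distance at most `1/2` from uniform. -/
lemma sd_uniform_le_half (p : PMF (Bits 1)) :
    sd p (PMF.uniformOfFintype (Bits 1)) ≤ 1 / 2 := by
  classical
  refine ciSup_le fun T => ?_
  have hp : 0 ≤ ∑ y ∈ T, (p y).toReal := sum_nonneg fun _ _ => ENNReal.toReal_nonneg
  have hp1 := sum_toReal_le_one p T
  have hq : ∑ y ∈ T, (PMF.uniformOfFintype (Bits 1) y).toReal = #T / 2 := by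
    simp [div_eq_mul_inv]
  have hT : #T ≤ 2 := by simpa using card_le_univ T
  rw [hq]
  interval_cases h : #T
  · simp [card_eq_zero.mp h]
  · rw [abs_le]
    constructor <;> push_cast <;> linarith
  · have hu : T = univ := by
      rw [← card_eq_iff_eq_univ]; simpa using h
    rw [hu, sum_toReal_eq_one]
    norm_num

/-- A decoder whose fibres are well distributed with respect to tampering by `f` is non-malleable
against `f`. -/
lemma exists_simulator {n k : ℕ} (D : BV n → Bits k) (f : BV n → BV n) {s : ℝ}
    (hne : ∀ x, (univ.filter fun c => D c = x).Nonempty)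
    (hs : s ≤ 2 ^ n / (2 * 2 ^ k))
    (h : ∀ (x : Bits k) (T : Finset (Bits k)), open Classical in
      |(#{c | D c = x ∧ TamperedMem f D x T c} : ℝ) -
        (#{c | TamperedMem f D x T c} : ℝ) / 2 ^ k| ≤ s) :
    ∃ G : PMF (Option (Bits k)), ∀ x : Bits k,
      sd ((PMF.uniformOfFinset _ (hne x)).map fun c => D (f c)) (G.map fun g => g.getD x) ≤
        4 * s * 2 ^ k / 2 ^ n := by
  classical
  refine ⟨(PMF.uniformOfFinset univ univ_nonempty).map
    fun c => if f c = c then none else some (D (f c)), fun x => ciSup_le fun T => ?_⟩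
  rw [PMF.map_comp, sum_map_uniformOfFinset_toReal, sum_map_uniformOfFinset_toReal]
  have e1 : (univ.filter fun c => D c = x).filter (fun c => D (f c) ∈ T) =
      univ.filter fun c => D c = x ∧ TamperedMem f D x T c := by
    ext c
    simp only [mem_filter, mem_univ, true_and]
    by_cases hc : f c = c
    · simp only [TamperedMem, hc, true_and, ne_eq, not_true_eq_false, false_and, or_false]
      exact and_congr_right fun hx => by rw [hx]
    · simp [TamperedMem, hc]
  have e2 : (univ.filter fun c => ((fun g : Option (Bits k) => g.getD x) ∘
      fun c => if f c = c then none else some (D (f c))) c ∈ T) =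
      univ.filter fun c => TamperedMem f D x T c := by
    ext c
    simp only [mem_filter, mem_univ, true_and]
    by_cases hc : f c = c <;> simp [TamperedMem, hc]
  rw [e1, e2]
  have hT := h x T
  have hU := h x univ
  have hall : ∀ c, TamperedMem f D x univ c := fun c => by
    simp [TamperedMem, em]
  have hN : (#(univ : Finset (BV n)) : ℝ) = 2 ^ n := by simp [ZMod.card]
  simp only [hall, and_true, filter_true] at hU
  have hwN : (#(univ.filter fun c => TamperedMem f D x T c) : ℝ) ≤ 2 ^ n := by
    rw [← hN]; exact_mod_cast card_le_univ _
  rw [hN] at hU ⊢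
  set a : ℝ := ((#(univ.filter fun c => D c = x ∧ TamperedMem f D x T c) : ℕ) : ℝ)
  set w : ℝ := ((#(univ.filter fun c => TamperedMem f D x T c) : ℕ) : ℝ)
  set q : ℝ := ((#(univ.filter fun c => D c = x) : ℕ) : ℝ)
  have hw0 : 0 ≤ w := by positivity
  have hN0 : (0 : ℝ) < 2 ^ n := by positivity
  have hK0 : (0 : ℝ) < 2 ^ k := by positivity
  generalize (2 : ℝ) ^ n = N at *
  generalize (2 : ℝ) ^ k = K at *
  have hq : N / (2 * K) ≤ q := by
    have := (abs_le.mp hU).1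
    have e : N / K = N / (2 * K) + N / (2 * K) := by field_simp; ring
    linarith
  have hq0 : 0 < q := lt_of_lt_of_le (by positivity) hq
  have hs0 : 0 ≤ s := (abs_nonneg _).trans hU
  have key : a / q - w / N = ((a - w / K) * N - w * (q - N / K)) / (q * N) := by
    field_simp
    ring
  rw [key, abs_div, abs_of_pos (mul_pos hq0 hN0), div_le_iff₀ (mul_pos hq0 hN0)]
  calc |(a - w / K) * N - w * (q - N / K)| ≤ |(a - w / K) * N| + |w * (q - N / K)| := abs_sub _ _
    _ = |a - w / K| * N + w * |q - N / K| := by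
        rw [abs_mul, abs_mul, abs_of_pos hN0, abs_of_nonneg hw0]
    _ ≤ s * N + N * s := by gcongr
    _ = 4 * s * K / N * (N / (2 * K) * N) := by field_simp; ring
    _ ≤ _ := by gcongr

lemma three_hundred_mul_sq_le_two_pow {k : ℕ} (hk : 20 ≤ k) : 300 * k ^ 2 ≤ 2 ^ k := by
  induction k, hk using Nat.le_induction with
  | base => norm_num
  | succ m hm ih => rw [pow_succ 2]; nlinarith

lemma deviation_le {n k : ℕ} (hk : 20 ≤ k) (hkn : 10 * k ≤ n) (hnk : n ≤ 11 * k) :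
    4 * ((2 * n + 1) * ((n ^ 2 + 3 * n + k + 2 ^ k + 2) / (1 / (2 ^ k) ^ 4) +
      1 / (2 ^ k) ^ 4 * 2 ^ n)) * 2 ^ k / 2 ^ n ≤ 1 / (2 : ℝ) ^ k := by
  have hX : (300 : ℝ) * k ^ 2 ≤ 2 ^ k := by exact_mod_cast three_hundred_mul_sq_le_two_pow hk
  have hN : ((2 : ℝ) ^ k) ^ 10 ≤ 2 ^ n := by
    rw [← pow_mul, mul_comm]; exact pow_le_pow_right₀ (by norm_num) hkn
  have hk' : (20 : ℝ) ≤ k := by exact_mod_cast hk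
  have hn' : (n : ℝ) ≤ 11 * k := by exact_mod_cast hnk
  have hX0 : (0 : ℝ) < 2 ^ k := by positivity
  have hN0 : (0 : ℝ) < 2 ^ n := by positivity
  have hn0 : (0 : ℝ) ≤ n := by positivity
  generalize (2 : ℝ) ^ n = N at *
  generalize (2 : ℝ) ^ k = X at *
  have h1 : (n : ℝ) ^ 2 + 3 * n + k + X + 2 ≤ 2 * X := by nlinarith
  have h2 : 2 * (n : ℝ) + 1 ≤ 23 * k := by linarith
  have hX1 : 6000 * (k : ℝ) ≤ X := by nlinarith
  have hX2 : 1 ≤ X := by linarith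
  calc 4 * ((2 * n + 1) * (((n : ℝ) ^ 2 + 3 * n + k + X + 2) / (1 / X ^ 4) +
      1 / X ^ 4 * N)) * X / N
      ≤ 4 * ((23 * k) * ((2 * X) / (1 / X ^ 4) + 1 / X ^ 4 * N)) * X / N := by gcongr
    _ = 92 * k * (2 * X ^ 6 / N + 1 / X ^ 3) := by field_simp; ring
    _ ≤ 92 * k * (2 * X ^ 6 / X ^ 10 + 1 / X ^ 3) := by gcongr
    _ = 92 * k * (2 / X + 1) / X ^ 3 := by field_simp
    _ ≤ X * 1 / X ^ 3 := by
        gcongr ?_ / X ^ 3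
        have : 2 / X ≤ 2 := div_le_self (by norm_num) hX2
        nlinarith
    _ = 1 / X / X := by field_simp
    _ ≤ 1 / X := div_le_self (by positivity) hX2

lemma exists_large_code {n k : ℕ} (hk : 20 ≤ k) (hkn : 10 * k ≤ n) (hnk : n ≤ 11 * k) :
    ∃ (E : Bits k → PMF (BV n)) (D : BV n → Bits k),
      (∀ x : Bits k, (E x).map D = PMF.pure x) ∧
      ∀ (M : BV n →ₗ[ZMod 2] BV n) (v : BV n), ∃ G : PMF (Option (Bits k)), ∀ x : Bits k,
        sd ((E x).map fun c => D (M c + v)) (G.map fun g => g.getD x) ≤ 1 / (2 : ℝ) ^ k := by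
  classical
  have hX1 : (1 : ℝ) ≤ (2 ^ k) ^ 4 := one_le_pow₀ (one_le_pow₀ (by norm_num))
  obtain ⟨D, hD⟩ := exists_decoder n k (l := 1 / (2 ^ k) ^ 4) (by positivity)
    (div_le_self zero_le_one hX1)
  have hdev := deviation_le hk hkn hnk
  set s : ℝ := (2 * n + 1) * ((n ^ 2 + 3 * n + k + 2 ^ k + 2) / (1 / (2 ^ k) ^ 4) +
      1 / (2 ^ k) ^ 4 * 2 ^ n) with hs_def
  have hK0 : (0 : ℝ) < 2 ^ k := by positivity
  have hN0 : (0 : ℝ) < 2 ^ n := by positivity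
  have hs : s < 2 ^ n / (2 * 2 ^ k) := by
    have h1 : 4 * s * 2 ^ k / 2 ^ n ≤ 1 := hdev.trans
      (by rw [div_le_one hK0]; exact one_le_pow₀ (by norm_num))
    rw [div_le_one hN0] at h1
    rw [lt_div_iff₀ (by positivity)]
    linarith
  have hne : ∀ x, (univ.filter fun c => D c = x).Nonempty := by
    intro x
    rw [← card_pos, Nat.pos_iff_ne_zero]
    intro h0
    have h := hD LinearMap.id 0 x univ
    have hall : ∀ c, TamperedMem (fun c => LinearMap.id (R := ZMod 2) c + (0 : BV n)) D x univ c :=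
      fun c => by simp [TamperedMem]
    simp only [hall, and_true, filter_true, h0, card_univ, Fintype.card_fun, ZMod.card,
      Fintype.card_fin] at h
    push_cast at h
    rw [zero_sub, abs_neg, abs_of_pos (by positivity)] at h
    have h2 : (2 : ℝ) ^ n / (2 * 2 ^ k) ≤ 2 ^ n / 2 ^ k := by
      gcongr; linarith
    linarith
  refine ⟨fun x => PMF.uniformOfFinset _ (hne x), D, fun x => ?_, fun M v => ?_⟩
  · ext y
    rw [← ENNReal.toReal_eq_toReal_iff' (PMF.apply_ne_top _ _) (PMF.apply_ne_top _ _)]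
    have hy := sum_map_uniformOfFinset_toReal _ (hne x) D {y}
    rw [sum_singleton] at hy
    rw [hy, PMF.pure_apply, filter_filter]
    by_cases h : y = x
    · have hc := card_pos.mpr (hne x)
      simp only [h, mem_singleton, and_self, if_true, ENNReal.toReal_one]
      exact div_self (by exact_mod_cast hc.ne')
    · have h0 : (univ.filter fun c => D c = x ∧ D c ∈ ({y} : Finset (Bits k))) = ∅ := by
        refine filter_eq_empty_iff.mpr fun c _ hc => h ?_
        rw [← hc.1, ← mem_singleton.mp hc.2]
      rw [h0]; simp [h]
  · obtain ⟨G, hG⟩ := exists_simulator D (fun c => M c + v) hne hs.le (hD M v)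
    exact ⟨G, fun x => (hG x).trans hdev⟩

lemma exists_one_bit_code {n : ℕ} (hn : 0 < n) :
    ∃ (E : Bits 1 → PMF (BV n)) (D : BV n → Bits 1),
      (∀ x : Bits 1, (E x).map D = PMF.pure x) ∧
      ∀ (M : BV n →ₗ[ZMod 2] BV n) (v : BV n), ∃ G : PMF (Option (Bits 1)), ∀ x : Bits 1,
        sd ((E x).map fun c => D (M c + v)) (G.map fun g => g.getD x) ≤ 1 / 2 := by
  refine ⟨fun x => PMF.pure fun _ => if x 0 then 1 else 0, fun c _ => decide (c ⟨0, hn⟩ = 1),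
    fun x => ?_, fun M v => ⟨(PMF.uniformOfFintype (Bits 1)).map some, fun x => ?_⟩⟩
  · rw [PMF.pure_map]
    congr 1
    funext i
    rw [Subsingleton.elim i 0]
    by_cases h : x 0 <;> simp [h]
  · rw [PMF.map_comp]
    have : (fun g : Option (Bits 1) => g.getD x) ∘ some = id := rfl
    rw [this, PMF.map_id]
    exact sd_uniform_le_half _

end

/-- Non-malleable codes against affine tampering with constant rate and exponentially
small error: there exist `ρ > 0` and `α > 0` such that for every `n` there are
`k ≥ ρ n`, a randomized encoder `E : {0,1}^k → {0,1}^n` and a decoder `D` with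
`D(E(x)) = x` with probability 1, such that for every affine tampering function
`f(c) = Mc + v` there is a distribution `G` over `NM_k` with
`Δ(D(f(E(x))), G(x)) ≤ 2^{-αk}` for every message `x`. -/
theorem stmt_12 :
    ∃ ρ : ℝ, ρ > 0 ∧
      ∃ α : ℝ, α > 0 ∧
        ∀ n : ℕ,
          ∃ k : ℕ, (k : ℝ) ≥ ρ * n ∧
            ∃ (E : Bits k → PMF (BV n)) (D : BV n → Bits k),
              (∀ x : Bits k, (E x).map D = PMF.pure x) ∧
              ∀ (M : BV n →ₗ[ZMod 2] BV n) (v : BV n),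
                ∃ G : PMF (Option (Bits k)),
                  ∀ x : Bits k,
                    sd ((E x).map fun c => D (M c + v))
                       (G.map fun g => g.getD x) ≤ (2 : ℝ) ^ (-(α * k)) := by
  refine ⟨1 / 240, by norm_num, 1, one_pos, fun n => ?_⟩
  have hpow : ∀ k : ℕ, (2 : ℝ) ^ (-(1 * (k : ℝ))) = 1 / 2 ^ k := fun k => by
    rw [one_mul, Real.rpow_neg (by norm_num), Real.rpow_natCast, one_div]
  simp only [hpow]
  rcases Nat.eq_zero_or_pos n with rfl | hn
  · refine ⟨0, by simp, fun _ => PMF.pure 0, fun _ => default, fun x => ?_, fun M v =>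
      ⟨PMF.pure none, fun x => by simpa using sd_le_one _ _⟩⟩
    rw [PMF.pure_map, Subsingleton.elim x]
  rcases lt_or_ge n 200 with h | h
  · refine ⟨1, ?_, by simpa using exists_one_bit_code hn⟩
    have : (n : ℝ) ≤ 200 := by exact_mod_cast h.le
    push_cast
    linarith
  · refine ⟨n / 10, ?_, exists_large_code (by omega) (by omega) (by omega)⟩
    have : (n : ℝ) ≤ 240 * ((n / 10 : ℕ) : ℝ) := by
      exact_mod_cast (show n ≤ 240 * (n / 10) by omega)
    linarith
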